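/- Let V be a real Hilbert space, a : V × V → ℝ a bounded coercive bilinear form, and let I_H : V → V be a continuous linear projection (I_H ∘ I_H = I_H) with closed kernel W = ker I_H and range V_H = I_H(V). Let Q : V → W be the correction operator defined by a(Q v, w) = a(v, w) for all w ∈ W. Then V decomposes as the direct sum V = (id − Q)(V_H) ⊕ W, and this splitting is a-orthogonal: a(u_ms, w) = 0 for every u_ms ∈ (id − Q)(V_H) and every w ∈ W. -/

import Mathlib

open MeasureTheory

/-- The `a`-orthogonal splitting `V = (id − Q)(V_H) ⊕ W` induced by the ideal correction
operator of the Localized Orthogonal Decomposition, where `I_H` is a continuous linear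
projection with kernel `W` and range `V_H`, and `Q : V → W` satisfies
`a(Q v, w) = a(v, w)` for all `w ∈ W`. -/
theorem lod_orthogonal_splitting
    {V : Type*} [NormedAddCommGroup V] [InnerProductSpace ℝ V] [CompleteSpace V]
    (a : V →ₗ[ℝ] V →ₗ[ℝ] ℝ) (C α : ℝ) (hα : 0 < α)
    (hbdd : ∀ u v : V, |a u v| ≤ C * ‖u‖ * ‖v‖)
    (hcoer : ∀ v : V, α * ‖v‖ ^ 2 ≤ a v v)
    (IH : V →L[ℝ] V) (hproj : ∀ v : V, IH (IH v) = IH v)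
    (Q : V → V) (hQmem : ∀ v : V, IH (Q v) = 0)
    (hQ : ∀ v w : V, IH w = 0 → a (Q v) w = a v w) :
    (∀ v : V, ∃! p : V × V,
        p.1 ∈ (fun x => x - Q x) '' (Set.range IH) ∧ IH p.2 = 0 ∧ v = p.1 + p.2) ∧
    (∀ ums ∈ (fun x => x - Q x) '' (Set.range IH), ∀ w : V, IH w = 0 → a ums w = 0) := by
  constructor
  · intro v
    refine ⟨(IH v - Q (IH v), v - IH v + Q (IH v)), ⟨⟨IH v, ⟨v, rfl⟩, rfl⟩, ?_, ?_⟩, ?_⟩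
    · simp [hproj, hQmem]
    · dsimp only
      abel
    · rintro ⟨u, w⟩ ⟨⟨_, ⟨x, rfl⟩, rfl⟩, hw, hv⟩
      have hx : IH v = IH x := by
        rw [hv]
        simp_all
      refine Prod.ext ?_ ?_
      · simp only [hx]
      · simp only [hx]
        rw [hv]
        dsimp only
        abel
  · rintro _ ⟨y, -, rfl⟩ w hw
    simp [hQ y w hw]
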